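/- Let f ∈ ℚ[x] be an irreducible polynomial of prime degree p with p > 37. If f has exactly 10 non-real complex roots, then the Galois group of f over ℚ is isomorphic to the alternating group A_p or to the symmetric group S_p. -/

import Mathlib

open Polynomial

/-- Over a field of characteristic `p`, a nonzero polynomial of degree less than `p` with at most
`k` terms is not divisible by `(X - 1) ^ k`. -/
lemma eq_zero_of_X_sub_one_pow_dvd_of_card_support_le {K : Type*} [Field K] (p : ℕ) [CharP K p]
    (k : ℕ) (f : K[X]) (hdvd : (X - 1) ^ k ∣ f) (hcard : f.support.card ≤ k)
    (hdeg : ∀ n ∈ f.support, n < p) : f = 0 := by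
  induction k generalizing f with
  | zero => simpa using hcard
  | succ k ih =>
    by_contra hf
    obtain ⟨m, hm⟩ := Polynomial.support_nonempty.mpr hf
    have hcoeff : ∀ n : ℕ, (X * derivative f - C (m : K) * f).coeff n = ((n : K) - m) * f.coeff n := by
      intro n
      cases n with
      | zero => simp
      | succ n =>
        simp only [coeff_sub, coeff_X_mul, coeff_derivative, coeff_C_mul, Nat.cast_succ]
        ring
    have hsub : (X * derivative f - C (m : K) * f).support ⊆ f.support.erase m := by
      intro n hn
      rw [mem_support_iff, hcoeff] at hn
      rw [Finset.mem_erase, mem_support_iff]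
      refine ⟨?_, right_ne_zero_of_mul hn⟩
      rintro rfl
      simp at hn
    have hzero : X * derivative f - C (m : K) * f = 0 := by
      apply ih
      · apply dvd_sub
        · apply Dvd.dvd.mul_left
          have := pow_sub_one_dvd_derivative_of_pow_dvd (p := f) (q := X - 1) hdvd
          simpa using this
        · exact ((pow_dvd_pow _ k.le_succ).trans hdvd).mul_left _
      · have := Finset.card_le_card hsub
        rw [Finset.card_erase_of_mem hm] at this
        omega
      · exact fun n hn => hdeg n (Finset.mem_of_mem_erase (hsub hn))
    have hmon : f = monomial m (f.coeff m) := by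
      ext n
      rw [coeff_monomial]
      split_ifs with h
      · rw [h]
      · by_contra hn
        have h1 := hcoeff n
        rw [hzero, coeff_zero, eq_comm, mul_eq_zero, or_iff_left hn, sub_eq_zero] at h1
        have := CharP.natCast_injOn_Iio K p (hdeg n (mem_support_iff.mpr hn)) (hdeg m hm) h1
        exact h this.symm
    have heval : f.eval 1 = 0 := by
      obtain ⟨g, hg⟩ := (dvd_pow_self (X - 1 : K[X]) k.succ_ne_zero).trans hdvd
      simp [hg]
    rw [hmon] at heval
    simp at heval
    exact mem_support_iff.mp hm heval

lemma lt_card_support_of_rootMultiplicity {K : Type*} [Field K] (p : ℕ) [CharP K p]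
    (f : K[X]) (hf : f ≠ 0) (hdeg : ∀ n ∈ f.support, n < p) :
    f.rootMultiplicity 1 < f.support.card := by
  by_contra! h
  refine hf (eq_zero_of_X_sub_one_pow_dvd_of_card_support_le p _ f ?_ h hdeg)
  simpa using f.pow_rootMultiplicity_dvd 1

/-- The polynomial of degree less than `p` whose coefficients are the values of `a`. -/
noncomputable def cyclicPolynomial {p : ℕ} (a : ZMod p → ZMod p) [NeZero p] : (ZMod p)[X] :=
  ∑ i, monomial i.val (a i)

lemma coeff_cyclicPolynomial {p : ℕ} [NeZero p] (a : ZMod p → ZMod p) (i : ZMod p) :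
    (cyclicPolynomial a).coeff i.val = a i := by
  simp only [cyclicPolynomial, finsetSum_coeff, coeff_monomial]
  rw [Finset.sum_eq_single i]
  · simp
  · intro j _ hj
    rw [if_neg]
    exact fun h => hj (ZMod.val_injective p h)
  · simp

lemma support_cyclicPolynomial {p : ℕ} [NeZero p] (a : ZMod p → ZMod p) :
    (cyclicPolynomial a).support ⊆ (Finset.univ.filter (a · ≠ 0)).image ZMod.val := by
  intro n hn
  rw [mem_support_iff, cyclicPolynomial, finsetSum_coeff] at hn
  obtain ⟨i, -, hi⟩ := Finset.exists_ne_zero_of_sum_ne_zero hn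
  rw [coeff_monomial] at hi
  simp only [Finset.mem_image, Finset.mem_filter, Finset.mem_univ, true_and]
  refine ⟨i, ?_, ?_⟩ <;> split_ifs at hi with h <;> first | assumption | simp at hi

/-- An uncertainty principle: if the convolution of two nonzero `ZMod p`-valued functions on
`ZMod p` vanishes, then their supports have at least `p + 2` elements in total. -/
lemma card_support_add_card_support_of_convolution_eq_zero {p : ℕ} [Fact p.Prime]
    (a b : ZMod p → ZMod p) (ha : a ≠ 0) (hb : b ≠ 0)
    (hconv : ∀ x, ∑ i, a i * b (x - i) = 0) :
    p + 2 ≤ (Finset.univ.filter (a · ≠ 0)).card + (Finset.univ.filter (b · ≠ 0)).card := by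
  have hne : ∀ c : ZMod p → ZMod p, c ≠ 0 → cyclicPolynomial c ≠ 0 := by
    intro c hc h
    apply hc
    ext i
    rw [← coeff_cyclicPolynomial c i, h]
    simp
  have hlt : ∀ c : ZMod p → ZMod p, c ≠ 0 →
      (cyclicPolynomial c).rootMultiplicity 1 < (Finset.univ.filter (c · ≠ 0)).card := by
    intro c hc
    refine (lt_card_support_of_rootMultiplicity p _ (hne c hc) ?_).trans_le
      ((Finset.card_le_card (support_cyclicPolynomial c)).trans Finset.card_image_le)
    intro n hn
    obtain ⟨i, -, rfl⟩ := Finset.mem_image.mp (support_cyclicPolynomial c hn)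
    exact i.val_lt
  have hmod : ∀ i j : ZMod p,
      (X ^ p - 1 : (ZMod p)[X]) ∣ X ^ (i.val + j.val) - X ^ (i + j).val := by
    intro i j
    rw [ZMod.val_add]
    nth_rw 1 [← Nat.mod_add_div (i.val + j.val) p]
    rw [pow_add, pow_mul, ← mul_sub_one]
    exact (sub_one_dvd_pow_sub_one _ _).mul_left _
  have hdvd : (X ^ p - 1 : (ZMod p)[X]) ∣ cyclicPolynomial a * cyclicPolynomial b := by
    have hprod : cyclicPolynomial a * cyclicPolynomial b =
        ∑ i, ∑ j, C (a i * b j) * (X ^ (i.val + j.val) - X ^ (i + j).val) := by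
      have hzero : ∑ i, ∑ j, C (a i * b j) * X ^ (i + j).val = (0 : (ZMod p)[X]) := by
        calc _ = ∑ i, ∑ x, C (a i * b (x - i)) * X ^ x.val := by
              refine Finset.sum_congr rfl fun i _ => ?_
              refine Fintype.sum_equiv (Equiv.addLeft i) _ _ fun j => ?_
              simp
          _ = ∑ x, C (∑ i, a i * b (x - i)) * X ^ x.val := by
              rw [Finset.sum_comm]
              simp only [map_sum, Finset.sum_mul]
          _ = 0 := by simp [hconv]
      simp only [mul_sub, Finset.sum_sub_distrib, hzero, sub_zero]
      simp only [cyclicPolynomial, Finset.sum_mul_sum, monomial_mul_monomial,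
        C_mul_X_pow_eq_monomial]
    rw [hprod]
    exact Finset.dvd_sum fun i _ => Finset.dvd_sum fun j _ => (hmod i j).mul_left _
  have hpow : (X ^ p - 1 : (ZMod p)[X]) = (X - C 1) ^ p := by
    rw [sub_pow_char]; simp
  have hmul := mul_ne_zero (hne a ha) (hne b hb)
  rw [hpow, ← le_rootMultiplicity_iff hmul, rootMultiplicity_mul hmul] at hdvd
  have := hlt a ha
  have := hlt b hb
  omega

/-- A non-identity permutation of `ZMod p` that preserves the Cayley digraph of a nonempty set
`U` of nonzero elements moves at least `p + 1 - #U` points. -/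
lemma card_add_card_support_of_preserves_differences {p : ℕ} [Fact p.Prime]
    (t : Equiv.Perm (ZMod p)) (ht : t ≠ 1) (U : Finset (ZMod p)) (hU : U.Nonempty) (h0 : 0 ∉ U)
    (hpres : ∀ x, ∀ u ∈ U, t (x + u) - t x ∈ U) : p + 1 ≤ U.card + t.support.card := by
  classical
  have hsum : ∀ x, ∑ u ∈ U, (t (x + u) - t x) = ∑ u ∈ U, u := by
    intro x
    have hinj : Function.Injective fun u => t (x + u) - t x := fun u v h => by simpa using h
    have himage : U.image (fun u => t (x + u) - t x) = U :=
      Finset.eq_of_subset_of_card_le (Finset.image_subset_iff.mpr (hpres x))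
        (Finset.card_image_of_injective U hinj).ge
    conv_rhs => rw [← himage, Finset.sum_image hinj.injOn]
  set a : ZMod p → ZMod p :=
    fun i => (if -i ∈ U then 1 else 0) - (if i = 0 then (U.card : ZMod p) else 0) with ha
  have hacard : (Finset.univ.filter (a · ≠ 0)).card ≤ U.card + 1 := by
    have : Finset.univ.filter (a · ≠ 0) ⊆ insert 0 (U.image Neg.neg) := by
      intro i hi
      simp only [Finset.mem_filter, Finset.mem_univ, true_and, ha] at hi
      simp only [Finset.mem_insert, Finset.mem_image]
      by_contra! h
      rw [if_neg h.1, if_neg (fun hu => h.2 _ hu (neg_neg i)), sub_zero] at hi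
      exact hi rfl
    calc _ ≤ _ := Finset.card_le_card this
      _ ≤ _ := Finset.card_insert_le _ _
      _ ≤ _ := Nat.add_le_add_right Finset.card_image_le 1
  have hane : a ≠ 0 := by
    obtain ⟨u, hu⟩ := hU
    intro h
    have := congrFun h (-u)
    have hu0 : u ≠ 0 := fun h => h0 (h ▸ hu)
    simp [ha, hu, hu0] at this
  have hbne : (fun x => t x - x) ≠ 0 := by
    intro h
    apply ht
    ext x
    exact sub_eq_zero.mp (congrFun h x)
  have hconv : ∀ x, ∑ i, a i * (t (x - i) - (x - i)) = 0 := by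
    intro x
    have h1 : ∑ i, (if -i ∈ U then 1 else 0) * (t (x - i) - (x - i)) =
        ∑ u ∈ U, (t (x + u) - (x + u)) := by
      rw [← Finset.sum_filter_add_sum_filter_not U (· ∈ Finset.univ)]
      simp only [ite_mul, one_mul, zero_mul, Finset.mem_univ, not_true_eq_false,
        Finset.filter_false, Finset.sum_empty, add_zero, Finset.filter_true]
      rw [← Fintype.sum_equiv (Equiv.neg (ZMod p))
        (fun u => if u ∈ U then t (x + u) - (x + u) else 0) _ (by intro u; simp)]
      simp
    simp only [ha, sub_mul, Finset.sum_sub_distrib, h1]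
    have h2 := hsum x
    simp only [Finset.sum_sub_distrib, Finset.sum_const, nsmul_eq_mul] at h2
    simp only [ite_mul, zero_mul, Finset.sum_ite_eq', Finset.mem_univ, if_true, sub_zero]
    rw [Finset.sum_add_distrib, Finset.sum_const, nsmul_eq_mul]
    linear_combination h2
  have := card_support_add_card_support_of_convolution_eq_zero a _ hane hbne hconv
  have hsupp : Finset.univ.filter (fun x => t x - x ≠ 0) = t.support := by
    ext x
    simp [sub_ne_zero]
  rw [hsupp] at this
  omega

/-- A permutation group of prime degree `p` and order divisible by `p` contains, after labelling
the points by `ZMod p`, all translations. -/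
lemma exists_equiv_zmod_translation_mem {α : Type*} [Fintype α] [DecidableEq α] {p : ℕ}
    [Fact p.Prime] (hcard : Fintype.card α = p) (G : Subgroup (Equiv.Perm α))
    (hdvd : p ∣ Nat.card G) :
    ∃ e : ZMod p ≃ α, ∀ k, ∃ g ∈ G, ∀ i, g (e i) = e (i + k) := by
  obtain ⟨⟨g, hgG⟩, hg⟩ := exists_prime_orderOf_dvd_card' p hdvd
  rw [Subgroup.orderOf_mk] at hg
  have hp : p.Prime := Fact.out
  have hcyc : g.IsCycle := Equiv.Perm.isCycle_of_prime_order'' (hcard ▸ hp) (hg.trans hcard.symm)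
  have hsupp : g.support = Finset.univ := by
    rw [← Finset.card_eq_iff_eq_univ, ← hcyc.orderOf, hg, hcard]
  obtain ⟨x, hx⟩ := hcyc.nonempty_support
  have hmod : ∀ n : ℕ, g ^ (n % p) = g ^ n := fun n => by rw [← hg, pow_mod_orderOf]
  have hadd : ∀ i k : ZMod p, (g ^ (i + k).val) x = (g ^ k.val) ((g ^ i.val) x) := by
    intro i k
    rw [← Equiv.Perm.mul_apply, ← pow_add, ZMod.val_add, hmod, add_comm]
  have hsurj : Function.Surjective fun i : ZMod p => (g ^ i.val) x := by
    intro y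
    have hy : y ∈ g.support := hsupp ▸ Finset.mem_univ y
    obtain ⟨n, hn⟩ := hcyc.exists_pow_eq (Equiv.Perm.mem_support.mp hx)
      (Equiv.Perm.mem_support.mp hy)
    refine ⟨(n : ZMod p), ?_⟩
    simp only [ZMod.val_natCast]
    rw [← hn, hmod]
  have hbij := (Fintype.bijective_iff_surjective_and_card fun i : ZMod p => (g ^ i.val) x).mpr
    ⟨hsurj, by rw [ZMod.card, hcard]⟩
  exact ⟨Equiv.ofBijective _ hbij, fun k => ⟨g ^ k.val, G.pow_mem hgG _, fun i => (hadd i k).symm⟩⟩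

/-- A permutation group of prime degree `p` and order divisible by `p` is doubly transitive
as soon as it contains a non-identity element moving at most about half of the points. -/
lemma exists_map_pair_of_small_support {α : Type*} [Fintype α] [DecidableEq α] {p : ℕ}
    [Fact p.Prime] (hcard : Fintype.card α = p) (G : Subgroup (Equiv.Perm α))
    (hdvd : p ∣ Nat.card G) (t : Equiv.Perm α) (htG : t ∈ G) (ht : t ≠ 1)
    (hsupp : t.support.card + (p - 1) / 2 ≤ p) (a b c d : α) (hab : a ≠ b) (hcd : c ≠ d) :
    ∃ g ∈ G, g a = c ∧ g b = d := by
  classical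
  obtain ⟨e, he⟩ := exists_equiv_zmod_translation_mem hcard G hdvd
  by_contra! hbad
  let R : ZMod p → ZMod p → Prop := fun i j => ∃ g ∈ G, g a = e i ∧ g b = e j
  have hRmap : ∀ h ∈ G, ∀ i j i' j', h (e i) = e i' → h (e j) = e j' → R i j → R i' j' := by
    rintro h hh i j i' j' hi hj ⟨g, hg, h1, h2⟩
    exact ⟨h * g, G.mul_mem hh hg, by simp [h1, hi], by simp [h2, hj]⟩
  have hRadd : ∀ k i j, R i j → R (i + k) (j + k) := by
    intro k i j h
    obtain ⟨g, hg, hge⟩ := he k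
    exact hRmap g hg i j _ _ (hge i) (hge j) h
  have hRiff : ∀ i j, R i j ↔ R 0 (j - i) := by
    intro i j
    refine ⟨fun h => by simpa [sub_eq_add_neg] using hRadd (-i) i j h, fun h => ?_⟩
    simpa using hRadd i _ _ h
  let t' : Equiv.Perm (ZMod p) := e.symm.permCongr t
  have ht'e : ∀ i, t (e i) = e (t' i) := by
    intro i
    simp [t']
  have hRt : ∀ i j, R i j ↔ R (t' i) (t' j) := by
    intro i j
    refine ⟨hRmap t htG _ _ _ _ (ht'e i) (ht'e j), hRmap t⁻¹ (G.inv_mem htG) _ _ _ _ ?_ ?_⟩ <;>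
    · rw [← ht'e]; simp
  have ht'1 : t' ≠ 1 := by
    intro h
    apply ht
    ext x
    have := ht'e (e.symm x)
    simpa [h] using this
  have ht'card : t'.support.card = t.support.card := by
    have : t.support = t'.support.map e.toEmbedding := by
      ext x
      simp [t', Equiv.Perm.mem_support, ← Equiv.eq_symm_apply]
    rw [this, Finset.card_map]
  have hR0 : ¬ R 0 0 := by
    rintro ⟨g, -, h1, h2⟩
    exact hab (g.injective (h1.trans h2.symm))
  set U := Finset.univ.filter fun u => R 0 u with hUdef
  set V := Finset.univ.filter fun u => u ≠ 0 ∧ ¬ R 0 u with hVdef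
  have hUV : U.card + V.card + 1 = p := by
    have h1 : U ∪ V = Finset.univ.erase 0 := by
      ext u
      simp only [hUdef, hVdef, Finset.mem_union, Finset.mem_filter, Finset.mem_univ, true_and,
        Finset.mem_erase, and_true]
      by_cases h : u = 0
      · simp [h, hR0]
      · tauto
    have h2 : Disjoint U V := by
      rw [Finset.disjoint_left]
      intro u hu hv
      exact (Finset.mem_filter.mp hv).2.2 (Finset.mem_filter.mp hu).2
    rw [← Finset.card_union_of_disjoint h2, h1, Finset.card_erase_of_mem (Finset.mem_univ _),
      Finset.card_univ, ZMod.card]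
    have := (Fact.out : p.Prime).pos
    omega
  have hUle := card_add_card_support_of_preserves_differences t' ht'1 U
    ⟨e.symm b - e.symm a, by
      rw [Finset.mem_filter, ← hRiff]
      exact ⟨Finset.mem_univ _, 1, G.one_mem, by simp, by simp⟩⟩
    (by simpa [hUdef] using hR0)
    (by
      intro x u hu
      simp only [hUdef, Finset.mem_filter, Finset.mem_univ, true_and] at hu ⊢
      rw [← hRiff, ← hRt, hRiff]
      simpa using hu)
  have hVle := card_add_card_support_of_preserves_differences t' ht'1 V
    ⟨e.symm d - e.symm c, by
      rw [Finset.mem_filter, ← hRiff]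
      refine ⟨Finset.mem_univ _, ?_, ?_⟩
      · rw [sub_ne_zero]
        exact fun h => hcd (e.symm.injective h).symm
      · rintro ⟨g, hg, h1, h2⟩
        exact hbad g hg (by simpa using h1) (by simpa using h2)⟩
    (by simp [hVdef])
    (by
      intro x u hu
      simp only [hVdef, Finset.mem_filter, Finset.mem_univ, true_and] at hu ⊢
      refine ⟨?_, ?_⟩
      · rw [sub_ne_zero]
        exact fun h => hu.1 (by simpa using t'.injective h)
      · rw [← hRiff, ← hRt, hRiff]
        simpa using hu.2)
  omega

/-- Averaging over a doubly transitive group: the number of pairs of a set `P` mapped into a set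
`Q` depends, on average, only on the cardinalities of `P` and `Q`. -/
lemma exists_sum_card_filter_pairs {α : Type*} [Fintype α] [DecidableEq α]
    (G : Subgroup (Equiv.Perm α)) [DecidablePred (· ∈ G)]
    (hG : ∀ a b c d : α, a ≠ b → c ≠ d → ∃ g ∈ G, g a = c ∧ g b = d) :
    ∃ N : ℕ, 0 < N ∧ ∀ P Q : Finset (α × α), (∀ x ∈ P, x.1 ≠ x.2) → (∀ x ∈ Q, x.1 ≠ x.2) →
      ∑ g with g ∈ G, (P.filter fun x => (g x.1, g x.2) ∈ Q).card = N * (P.card * Q.card) := by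
  have hle : ∀ x y x' y' : α × α, x.1 ≠ x.2 → y.1 ≠ y.2 → x'.1 ≠ x'.2 → y'.1 ≠ y'.2 →
      ((Finset.univ.filter (· ∈ G)).filter fun g => (g x.1, g x.2) = y).card ≤
        ((Finset.univ.filter (· ∈ G)).filter fun g => (g x'.1, g x'.2) = y').card := by
    intro x y x' y' hx hy hx' hy'
    obtain ⟨k, hk, hk1, hk2⟩ := hG _ _ _ _ hx' hx
    obtain ⟨l, hl, hl1, hl2⟩ := hG _ _ _ _ hy hy'
    refine Finset.card_le_card_of_injOn (fun g => l * g * k) ?_ ?_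
    · intro g hg
      simp only [Finset.coe_filter, Finset.mem_filter, Finset.mem_univ, true_and,
        Set.mem_ofPred_eq, Prod.ext_iff] at hg ⊢
      refine ⟨G.mul_mem (G.mul_mem hl hg.1) hk, ?_, ?_⟩
      · simp [hk1, hg.2.1, hl1]
      · simp [hk2, hg.2.2, hl2]
    · intro g _ h _ hgh
      simpa using hgh
  by_cases hα : ∃ z : α × α, z.1 ≠ z.2
  · obtain ⟨z, hz⟩ := hα
    refine ⟨((Finset.univ.filter (· ∈ G)).filter fun g => (g z.1, g z.2) = z).card, ?_, ?_⟩
    · rw [Finset.card_pos]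
      exact ⟨1, by simp [G.one_mem]⟩
    · intro P Q hP hQ
      have hcount : ∀ g : Equiv.Perm α, (P.filter fun x => (g x.1, g x.2) ∈ Q).card =
          ∑ x ∈ P, ∑ y ∈ Q, if (g x.1, g x.2) = y then 1 else 0 := by
        intro g
        simp
      simp_rw [hcount]
      rw [Finset.sum_comm]
      have hinner : ∀ x ∈ P, ∀ y ∈ Q,
          (∑ g with g ∈ G, if (g x.1, g x.2) = y then 1 else 0) =
          ((Finset.univ.filter (· ∈ G)).filter fun g => (g z.1, g z.2) = z).card := by
        intro x hx y hy
        rw [← Finset.card_filter]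
        exact le_antisymm (hle _ _ _ _ (hP x hx) (hQ y hy) hz hz)
          (hle _ _ _ _ hz hz (hP x hx) (hQ y hy))
      rw [Finset.sum_congr rfl fun x hx => by
        rw [Finset.sum_comm, Finset.sum_congr rfl fun y hy => hinner x hx y hy]]
      simp only [Finset.sum_const, smul_eq_mul]
      ring
  · push Not at hα
    refine ⟨1, one_pos, fun P Q hP _ => ?_⟩
    have : P = ∅ := Finset.eq_empty_of_forall_notMem fun x hx => hP x hx (hα x)
    simp [this]

lemma card_filter_offDiag {α : Type*} [DecidableEq α] (D : Finset α) (g : Equiv.Perm α) :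
    (D.offDiag.filter fun x => (g x.1, g x.2) ∈ D.offDiag).card =
      (D.filter fun a => g a ∈ D).card * ((D.filter fun a => g a ∈ D).card - 1) := by
  have : (D.offDiag.filter fun x => (g x.1, g x.2) ∈ D.offDiag) =
      (D.filter fun a => g a ∈ D).offDiag := by
    ext x
    simp only [Finset.mem_filter, Finset.mem_offDiag, ne_eq, EmbeddingLike.apply_eq_iff_eq]
    tauto
  rw [this, Finset.offDiag_card, Nat.mul_sub_one]

/-- Averaging over a doubly transitive group: the number of points of `D` that stay in `D`. -/
lemma sum_card_filter_mem_eq {α : Type*} [Fintype α] [DecidableEq α]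
    (G : Subgroup (Equiv.Perm α)) [DecidablePred (· ∈ G)] (N : ℕ)
    (hcount : ∀ P Q : Finset (α × α), (∀ x ∈ P, x.1 ≠ x.2) → (∀ x ∈ Q, x.1 ≠ x.2) →
      ∑ g with g ∈ G, (P.filter fun x => (g x.1, g x.2) ∈ Q).card = N * (P.card * Q.card))
    (D : Finset α) :
    (Fintype.card α - 1) * ∑ g with g ∈ G, (D.filter fun a => g a ∈ D).card =
      N * (D.card * (Fintype.card α - 1) * (D.card * (Fintype.card α - 1))) := by
  have hcard : ∀ E : Finset α, ((E ×ˢ Finset.univ).filter fun x => x.1 ≠ x.2).card =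
      E.card * (Fintype.card α - 1) := by
    intro E
    rw [Finset.card_filter, Finset.sum_product]
    have : ∀ a ∈ E, (∑ b : α, if a ≠ b then 1 else 0) = Fintype.card α - 1 := by
      intro a _
      rw [← Finset.card_filter, Finset.filter_ne, Finset.card_erase_of_mem (Finset.mem_univ a),
        Finset.card_univ]
    rw [Finset.sum_congr rfl this, Finset.sum_const, smul_eq_mul]
  have h := hcount ((D ×ˢ Finset.univ).filter fun x => x.1 ≠ x.2)
    ((D ×ˢ Finset.univ).filter fun x => x.1 ≠ x.2) (fun x hx => (Finset.mem_filter.mp hx).2)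
    (fun x hx => (Finset.mem_filter.mp hx).2)
  rw [hcard] at h
  rw [← h, Finset.mul_sum]
  refine Finset.sum_congr rfl fun g _ => ?_
  rw [mul_comm, ← hcard]
  congr 1
  ext x
  simp only [Finset.mem_filter, Finset.mem_product, Finset.mem_univ, and_true, ne_eq,
    EmbeddingLike.apply_eq_iff_eq]
  tauto

/-- Two permutations whose supports meet in exactly one point have a 3-cycle as commutator. -/
lemma isThreeCycle_commutator_of_support_inter_eq_singleton {α : Type*} [Fintype α]
    [DecidableEq α] (u v : Equiv.Perm α) (z : α) (h : u.support ∩ v.support = {z}) :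
    (u * v * u⁻¹ * v⁻¹).IsThreeCycle := by
  have hmeet : ∀ x, u x ≠ x → v x ≠ x → x = z := by
    intro x hu hv
    rw [← Finset.mem_singleton, ← h]
    simp [hu, hv]
  have hz : u z ≠ z ∧ v z ≠ z := by
    have : z ∈ u.support ∩ v.support := h ▸ Finset.mem_singleton_self z
    simpa using this
  have huu' : ∀ x, u (u⁻¹ x) = x := fun x => by simp
  have hvv' : ∀ x, v (v⁻¹ x) = x := fun x => by simp
  have hu'u : ∀ x, u⁻¹ (u x) = x := fun x => by simp
  have hv'v : ∀ x, v⁻¹ (v x) = x := fun x => by simp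
  have huinv : ∀ x, u x = x → u⁻¹ x = x := fun x hx => by
    rw [Equiv.Perm.inv_eq_iff_eq]; exact hx.symm
  have hvinv : ∀ x, v x = x → v⁻¹ x = x := fun x hx => by
    rw [Equiv.Perm.inv_eq_iff_eq]; exact hx.symm
  have huu : ∀ x, u x ≠ x → u (u x) ≠ u x := fun x hx h => hx (u.injective h)
  have hvv : ∀ x, v x ≠ x → v (v x) ≠ v x := fun x hx h => hx (v.injective h)
  have hvuz : v (u z) = u z := by
    by_contra hc
    exact hz.1 (hmeet _ (huu z hz.1) hc)
  have huvz : u (v z) = v z := by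
    by_contra hc
    exact hz.2 (hmeet _ hc (hvv z hz.2))
  have hvfix : ∀ x, x ≠ u z → v (u⁻¹ x) = u⁻¹ x ∨ u x = x := by
    intro x hx
    by_contra! hc
    have h1 : u (u⁻¹ x) ≠ u⁻¹ x := by
      intro hh
      have h2 : u⁻¹ x = x := by simpa using hh.symm
      rw [h2] at hh
      exact hc.2 hh
    exact hx (by rw [← hmeet _ h1 hc.1]; simp)
  have hufix : ∀ x, x ≠ v z → u (v⁻¹ x) = v⁻¹ x ∨ v x = x := by
    intro x hx
    by_contra! hc
    have h1 : v (v⁻¹ x) ≠ v⁻¹ x := by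
      intro hh
      have h2 : v⁻¹ x = x := by simpa using hh.symm
      rw [h2] at hh
      exact hc.2 hh
    exact hx (by rw [← hmeet _ hc.1 h1]; simp)
  have hcz : (u * v * u⁻¹ * v⁻¹) z = u z := by
    have h1 : u (v⁻¹ z) = v⁻¹ z := (hufix z (Ne.symm hz.2)).resolve_right hz.2
    simp only [Equiv.Perm.mul_apply]
    rw [huinv _ h1, hvv']
  have hcvz : (u * v * u⁻¹ * v⁻¹) (v z) = z := by
    have h1 : v (u⁻¹ z) = u⁻¹ z := (hvfix z (Ne.symm hz.1)).resolve_right hz.1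
    simp only [Equiv.Perm.mul_apply]
    rw [hv'v, h1, huu']
  have hcuz : (u * v * u⁻¹ * v⁻¹) (u z) = v z := by
    simp only [Equiv.Perm.mul_apply]
    rw [hvinv _ hvuz, hu'u, huvz]
  have huzvz : u z ≠ v z := by
    intro hh
    rw [hh] at hvuz
    exact hvv z hz.2 hvuz
  rw [← card_support_eq_three_iff]
  have hsupp : (u * v * u⁻¹ * v⁻¹).support = {z, u z, v z} := by
    ext x
    simp only [Equiv.Perm.mem_support, Finset.mem_insert, Finset.mem_singleton]
    constructor
    · contrapose!
      rintro ⟨hx1, hx2, hx3⟩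
      simp only [Equiv.Perm.mul_apply]
      by_cases hvx : v x = x
      · rw [hvinv _ hvx]
        rcases hvfix x hx2 with h1 | h1
        · rw [h1]; simp
        · rw [huinv _ h1, hvx, h1]
      · have h1 := (hufix x hx3).resolve_right hvx
        have h2 : u x = x := by
          by_contra hc
          exact hx1 (hmeet x hc hvx)
        rw [huinv _ h1]
        simpa using h2
    · rintro (rfl | rfl | rfl)
      · rw [hcz]; exact hz.1
      · rw [hcuz]; exact huzvz.symm
      · rw [hcvz]; exact hz.2.symm
  rw [hsupp, Finset.card_eq_three]
  exact ⟨z, u z, v z, hz.1.symm, hz.2.symm, huzvz, rfl⟩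

/-- A doubly transitive group of degree `n` with a non-identity element moving `m` points, where
`(m - 1) ^ 2 < n - 1`, contains a 3-cycle. -/
lemma exists_isThreeCycle_of_small_support {α : Type*} [Fintype α] [DecidableEq α]
    (G : Subgroup (Equiv.Perm α))
    (hG : ∀ a b c d : α, a ≠ b → c ≠ d → ∃ g ∈ G, g a = c ∧ g b = d)
    (u : Equiv.Perm α) (huG : u ∈ G) (hu : u ≠ 1)
    (hsmall : (u.support.card - 1) ^ 2 < Fintype.card α - 1) :
    ∃ σ ∈ G, σ.IsThreeCycle := by
  classical
  obtain ⟨N, hN, hcount⟩ := exists_sum_card_filter_pairs G hG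
  set D := u.support with hD
  set n := Fintype.card α with hn
  have hDpos : 0 < D.card := by
    rw [Finset.card_pos, hD, Finset.nonempty_iff_ne_empty, Ne, Equiv.Perm.support_eq_empty_iff]
    exact hu
  let X : Equiv.Perm α → ℕ := fun g => (D.filter fun a => g a ∈ D).card
  suffices h : ∃ g ∈ G, X g = 1 by
    obtain ⟨g, hg, hX⟩ := h
    obtain ⟨z, hz⟩ := Finset.card_eq_one.mp hX
    refine ⟨_, ?_, isThreeCycle_commutator_of_support_inter_eq_singleton u (g⁻¹ * u * g) z ?_⟩
    · have hv : g⁻¹ * u * g ∈ G := G.mul_mem (G.mul_mem (G.inv_mem hg) huG) hg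
      exact G.mul_mem (G.mul_mem (G.mul_mem huG hv) (G.inv_mem huG)) (G.inv_mem hv)
    · rw [← hz]
      ext x
      simp [hD, Equiv.symm_apply_eq]
  by_contra! hX
  have hoff := hcount D.offDiag D.offDiag (fun x hx => (Finset.mem_offDiag.mp hx).2.2)
    (fun x hx => (Finset.mem_offDiag.mp hx).2.2)
  have hone := sum_card_filter_mem_eq G N hcount D
  have hpt : ∀ g ∈ Finset.univ.filter (· ∈ G), X g ≤
      (D.offDiag.filter fun x => (g x.1, g x.2) ∈ D.offDiag).card := by
    intro g hg
    rw [card_filter_offDiag]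
    change X g ≤ X g * (X g - 1)
    have := hX g (Finset.mem_filter.mp hg).2
    rcases Nat.lt_or_ge (X g) 2 with h | h
    · interval_cases X g <;> simp_all
    · exact Nat.le_mul_of_pos_right _ (by omega)
  have hsum := Finset.sum_le_sum hpt
  rw [hoff, Finset.offDiag_card, ← Nat.mul_sub_one] at hsum
  have h2 : N * (D.card * (n - 1) * (D.card * (n - 1))) ≤
      (n - 1) * (N * (D.card * (D.card - 1) * (D.card * (D.card - 1)))) := by
    rw [← hone]
    exact Nat.mul_le_mul_left _ hsum
  have hpos : 0 < N * D.card * D.card * (n - 1) :=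
    Nat.mul_pos (Nat.mul_pos (Nat.mul_pos hN hDpos) hDpos) (by omega)
  have h3 : n - 1 ≤ (D.card - 1) ^ 2 := by
    refine Nat.le_of_mul_le_mul_left ?_ hpos
    calc _ = N * (D.card * (n - 1) * (D.card * (n - 1))) := by ring
      _ ≤ _ := h2
      _ = _ := by ring
  omega

/-- The points moved by the commutator of two involutions are controlled by the points moved by
both. -/
lemma support_commutator_involutions_subset {α : Type*} [Fintype α] [DecidableEq α]
    (t s : Equiv.Perm α) (ht : ∀ x, t (t x) = x) (hs : ∀ x, s (s x) = x) :
    (t * s * t * s).support ⊆ (t.support ∩ s.support) ∪ (t.support ∩ s.support).image t ∪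
      (t.support ∩ s.support).image s := by
  intro x
  contrapose!
  simp only [Finset.mem_union, Finset.mem_image, Finset.mem_inter, Equiv.Perm.mem_support,
    Equiv.Perm.mul_apply, not_or, not_exists, not_and, and_imp, ne_eq, not_not]
  intro h1 h2 h3
  by_cases htx : t x = x
  · by_cases hsx : s x = x
    · simp [htx, hsx]
    · have h4 : t (s x) = s x := by
        by_contra hc
        exact h3 (s x) hc (fun h => hsx (s.injective h)) (hs x)
      rw [h4, hs, htx]
  · have hsx := h1 htx
    have h4 : s (t x) = t x := by
      by_contra hc
      exact h2 (t x) (fun h => htx (t.injective h)) hc (ht x)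
    rw [hsx, h4, ht]

lemma even_card_of_involution {α : Type*} (I : Finset α) (t : α → α)
    (ht : ∀ x, t (t x) = x) (hfix : ∀ x ∈ I, t x ≠ x) (hI : ∀ x ∈ I, t x ∈ I) :
    Even I.card := by
  have h : ∑ _x ∈ I, (1 : ZMod 2) = 0 :=
    Finset.sum_involution (fun x _ => t x) (fun _ _ => by decide) (fun x hx _ => hfix x hx) hI
      (fun x _ => ht x)
  rw [Finset.sum_const, nsmul_one, ZMod.natCast_eq_zero_iff] at h
  exact even_iff_two_dvd.mpr h

/-- For two involutions moving few points in common, either the commutator is a non-identity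
permutation moving at most 7 points, or a numerical inequality holds. -/
lemma small_commutator_or_inequality {α : Type*} [Fintype α] [DecidableEq α]
    (t s : Equiv.Perm α) (ht : ∀ x, t (t x) = x) (hs : ∀ x, s (s x) = x) (I : Finset α)
    (hI : I = t.support ∩ s.support) :
    (t * s * t * s ≠ 1 ∧ (t * s * t * s).support.card ≤ 7) ∨
      2 * I.card + (I.filter fun a => t a ∈ I).card ≤
        I.card * (I.card - 1) + 2 * (I.filter fun a => s a = t a).card := by
  have hsub := support_commutator_involutions_subset t s ht hs
  rw [← hI] at hsub
  have hmem : ∀ x, x ∈ I ↔ t x ≠ x ∧ s x ≠ x := by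
    intro x
    simp [hI]
  have hDle : (I.filter fun a => t a ∈ I).card ≤ I.card := Finset.card_filter_le _ _
  have himt : (I.image t).card ≤ I.card := Finset.card_image_le
  have hims : (I.image s).card ≤ I.card := Finset.card_image_le
  have hsuppcard := (Finset.card_le_card hsub).trans (Finset.card_union_le _ _)
  have hunion := Finset.card_union_le I (I.image t)
  by_cases hcomm : t * s * t * s = 1
  · have hts : ∀ x, t (s x) = s (t x) := by
      intro x
      have h := congrArg (fun σ : Equiv.Perm α => σ (s (t x))) hcomm
      simpa [hs, ht] using h
    have htI : ∀ x ∈ I, t x ∈ I := by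
      intro x hx
      rw [hmem] at hx ⊢
      refine ⟨fun h => hx.1 (t.injective h), fun h => hx.2 ?_⟩
      rw [← hts] at h
      exact t.injective h
    have hsI : ∀ x ∈ I, s x ∈ I := by
      intro x hx
      rw [hmem] at hx ⊢
      refine ⟨fun h => hx.1 ?_, fun h => hx.2 (s.injective h)⟩
      rw [hts] at h
      exact s.injective h
    obtain ⟨k, hk⟩ := even_card_of_involution I t ht (fun x hx => ((hmem x).mp hx).1) htI
    right
    by_cases hk1 : k = 1
    · have hcard : I.card = 2 := by omega
      have hC : (I.filter fun a => s a = t a) = I := by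
        rw [Finset.filter_eq_self]
        intro a ha
        have h1 := Finset.card_erase_of_mem ha
        have h2 : (I.erase a).card ≤ 1 := by omega
        exact Finset.card_le_one.mp h2 _ (Finset.mem_erase.mpr ⟨((hmem a).mp ha).2, hsI a ha⟩) _
          (Finset.mem_erase.mpr ⟨((hmem a).mp ha).1, htI a ha⟩)
      rw [hC, hcard]
      omega
    · rcases Nat.eq_zero_or_pos k with h0 | hpos
      · omega
      · have : I.card * 3 ≤ I.card * (I.card - 1) := Nat.mul_le_mul_left _ (by omega)
        omega
  · rcases lt_trichotomy I.card 3 with h | h | h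
    · exact Or.inl ⟨hcomm, by omega⟩
    · rcases Nat.eq_zero_or_pos (I.filter fun a => t a ∈ I).card with h0 | hpos
      · right
        rw [h0, h]
        omega
      · left
        refine ⟨hcomm, ?_⟩
        obtain ⟨a, ha⟩ := Finset.card_pos.mp hpos
        rw [Finset.mem_filter] at ha
        have h2 : 2 ≤ (I ∩ I.image t).card := by
          have : ({a, t a} : Finset α) ⊆ I ∩ I.image t := by
            intro x hx
            rw [Finset.mem_insert, Finset.mem_singleton] at hx
            rw [Finset.mem_inter, Finset.mem_image]
            rcases hx with rfl | rfl
            · exact ⟨ha.1, t x, ha.2, ht x⟩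
            · exact ⟨ha.2, a, ha.1, rfl⟩
          rw [← Finset.card_pair ((hmem a).mp ha.1).1.symm]
          exact Finset.card_le_card this
        have h3 := Finset.card_union_add_card_inter I (I.image t)
        omega
    · right
      have : I.card * 3 ≤ I.card * (I.card - 1) := Nat.mul_le_mul_left _ (by omega)
      omega

/-- A doubly transitive group of degree at least 39 with an involution moving exactly 10 points
contains a non-identity element moving at most 7 points. -/
lemma exists_small_support_of_involution {α : Type*} [Fintype α] [DecidableEq α]
    (G : Subgroup (Equiv.Perm α))
    (hG : ∀ a b c d : α, a ≠ b → c ≠ d → ∃ g ∈ G, g a = c ∧ g b = d)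
    (t : Equiv.Perm α) (htG : t ∈ G) (ht : ∀ x, t (t x) = x) (ht10 : t.support.card = 10)
    (hn : 39 ≤ Fintype.card α) :
    ∃ u ∈ G, u ≠ 1 ∧ u.support.card ≤ 7 := by
  classical
  obtain ⟨N, hN, hcount⟩ := exists_sum_card_filter_pairs G hG
  by_contra! hbad
  set D := t.support with hD
  set T : Finset (α × α) := D.image fun a => (a, t a) with hT
  have hinj : Function.Injective fun a => (a, t a) := fun a b h => (Prod.ext_iff.mp h).1
  have hTcard : T.card = 10 := by rw [hT, Finset.card_image_of_injective _ hinj, ht10]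
  have hTne : ∀ x ∈ T, x.1 ≠ x.2 := by
    intro x hx
    obtain ⟨a, ha, rfl⟩ := Finset.mem_image.mp hx
    exact (Equiv.Perm.mem_support.mp ha).symm
  have hDne : ∀ x ∈ D.offDiag, x.1 ≠ x.2 := fun x hx => (Finset.mem_offDiag.mp hx).2.2
  have hoff : D.offDiag.card = 90 := by rw [Finset.offDiag_card, ht10]
  have hsX := sum_card_filter_mem_eq G N hcount D
  have hsO := hcount D.offDiag D.offDiag hDne hDne
  have hsE := hcount T D.offDiag hTne hDne
  have hsC := hcount T T hTne hTne
  have hpt : ∀ g ∈ Finset.univ.filter (· ∈ G),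
      2 * (D.filter fun a => g a ∈ D).card +
        (T.filter fun x => (g x.1, g x.2) ∈ D.offDiag).card ≤
      (D.offDiag.filter fun x => (g x.1, g x.2) ∈ D.offDiag).card +
        2 * (T.filter fun x => (g x.1, g x.2) ∈ T).card := by
    intro g hg
    have hgG := (Finset.mem_filter.mp hg).2
    set s := g⁻¹ * t * g with hsdef
    have hsG : s ∈ G := G.mul_mem (G.mul_mem (G.inv_mem hgG) htG) hgG
    have hgs : ∀ x, g (s x) = t (g x) := fun x => by simp [hsdef]
    have hs : ∀ x, s (s x) = x := fun x => g.injective (by rw [hgs, hgs, ht])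
    have hI : (D.filter fun a => g a ∈ D) = t.support ∩ s.support := by
      ext x
      rw [Finset.mem_filter, Finset.mem_inter, Equiv.Perm.mem_support (f := s), hD,
        Equiv.Perm.mem_support (x := g x), ← hgs, ne_eq, g.injective.eq_iff]
    have hE : (T.filter fun x => (g x.1, g x.2) ∈ D.offDiag) =
        ((D.filter fun a => g a ∈ D).filter
          fun a => t a ∈ D.filter fun a => g a ∈ D).image fun a => (a, t a) := by
      rw [hT, Finset.filter_image, Finset.filter_filter]
      congr 1
      refine Finset.filter_congr fun a ha => ?_
      have h1 : t a ∈ D := by rw [hD] at ha ⊢; exact Equiv.Perm.apply_mem_support.mpr ha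
      have h2 : a ≠ t a := (Equiv.Perm.mem_support.mp ha).symm
      simp [h1, h2]
    have hC : (T.filter fun x => (g x.1, g x.2) ∈ T) =
        ((D.filter fun a => g a ∈ D).filter fun a => s a = t a).image fun a => (a, t a) := by
      have hmemT : ∀ x ∈ T, (g x.1, g x.2) ∈ T ↔ g x.1 ∈ D ∧ t (g x.1) = g x.2 := by
        simp [hT]
      rw [Finset.filter_congr hmemT, hT, Finset.filter_image, Finset.filter_filter]
      congr 1
      refine Finset.filter_congr fun a ha => ?_
      rw [← g.injective.eq_iff (a := s a), hgs]
    rw [hE, hC, Finset.card_image_of_injective _ hinj, Finset.card_image_of_injective _ hinj,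
      card_filter_offDiag]
    rcases small_commutator_or_inequality t s ht hs _ hI with ⟨h1, h2⟩ | h
    · have h3 := hbad _ (G.mul_mem (G.mul_mem (G.mul_mem htG hsG) htG) hsG) h1
      omega
    · exact h
  have hsum := Finset.sum_le_sum hpt
  rw [Finset.sum_add_distrib, Finset.sum_add_distrib, ← Finset.mul_sum, ← Finset.mul_sum,
    hsO, hsE, hsC, hTcard, hoff] at hsum
  rw [ht10] at hsX
  obtain ⟨k, hk⟩ : ∃ k, Fintype.card α = k + 1 := ⟨_, (Nat.sub_add_cancel (by omega)).symm⟩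
  rw [show Fintype.card α - 1 = k by omega] at hsX
  have hk38 : 38 ≤ k := by omega
  have h1 := Nat.mul_le_mul_left k hsum
  have h2 : N * k * (200 * k) ≤ N * k * 7400 := by
    rw [mul_add, mul_left_comm, hsX] at h1
    linarith
  have h3 := Nat.le_of_mul_le_mul_left h2 (Nat.mul_pos hN (by omega))
  omega

/-- A permutation group of prime degree `p > 37` and order divisible by `p` contains the
alternating group if it contains an involution moving exactly 10 points. -/
lemma alternatingGroup_le_of_involution_card_support_eq_ten {α : Type*} [Fintype α]
    [DecidableEq α] {p : ℕ} (hp : p.Prime) (hpgt : 37 < p) (hcard : Fintype.card α = p)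
    (G : Subgroup (Equiv.Perm α)) (hdvd : p ∣ Nat.card G) (t : Equiv.Perm α) (htG : t ∈ G)
    (ht : ∀ x, t (t x) = x) (ht10 : t.support.card = 10) : alternatingGroup α ≤ G := by
  have : Fact p.Prime := ⟨hp⟩
  have hp41 : 39 ≤ p := by
    by_contra! h
    obtain rfl : p = 38 := by omega
    norm_num at hp
  have ht1 : t ≠ 1 := by
    rintro rfl
    simp at ht10
  have h2 := exists_map_pair_of_small_support hcard G hdvd t htG ht1 (by omega)
  obtain ⟨u, huG, hu1, hu7⟩ :=
    exists_small_support_of_involution G h2 t htG ht ht10 (hcard ▸ hp41)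
  obtain ⟨σ, hσG, hσ⟩ := exists_isThreeCycle_of_small_support G h2 u huG hu1 (by
    have : (u.support.card - 1) ^ 2 ≤ 6 ^ 2 := Nat.pow_le_pow_left (by omega) 2
    omega)
  have h2G : MulAction.IsMultiplyPretransitive G α 2 := by
    rw [MulAction.is_two_pretransitive_iff]
    intro a b c d hab hcd
    obtain ⟨g, hg, h1, h2⟩ := h2 a b c d hab hcd
    exact ⟨⟨g, hg⟩, h1, h2⟩
  exact Equiv.Perm.alternatingGroup_le_of_isPreprimitive_of_isThreeCycle_mem
    (MulAction.isPreprimitive_of_is_two_pretransitive h2G) hσ hσG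

/-- A subgroup of the symmetric group containing the alternating group is one of the two. -/
lemma eq_alternatingGroup_or_eq_top_of_alternatingGroup_le {α : Type*} [Fintype α]
    [DecidableEq α] [Nontrivial α] (G : Subgroup (Equiv.Perm α)) (hG : alternatingGroup α ≤ G) :
    G = alternatingGroup α ∨ G = ⊤ := by
  have h := Subgroup.index_dvd_of_le hG
  rw [alternatingGroup.index_eq_two, Nat.dvd_prime Nat.prime_two] at h
  rcases h with h | h
  · exact Or.inr (Subgroup.index_eq_one.mp h)
  · exact Or.inl (Equiv.Perm.eq_alternatingGroup_of_index_eq_two h)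

/-- Complex conjugation, as a permutation of the complex roots of a rational polynomial, moves
exactly the non-real roots. -/
lemma card_support_galActionHom_conj (f : ℚ[X]) (hf : f ≠ 0)
    [Fact ((f.map (algebraMap ℚ ℂ)).Splits)] :
    (Gal.galActionHom f ℂ
      (Gal.restrict f ℂ (AlgEquiv.restrictScalars ℚ Complex.conjAe))).support.card =
      {z : ℂ | aeval z f = 0 ∧ z.im ≠ 0}.ncard := by
  rw [← Set.ncard_coe_finset, ← Set.ncard_image_of_injective _ Subtype.coe_injective]
  congr 1
  ext z
  have hfix : ∀ w : f.rootSet ℂ, Gal.galActionHom f ℂ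
      (Gal.restrict f ℂ (AlgEquiv.restrictScalars ℚ Complex.conjAe)) w = w ↔ w.val.im = 0 := by
    intro w
    rw [Subtype.ext_iff, Gal.galActionHom_restrict]
    exact Complex.conj_eq_iff_im
  simp only [Set.mem_image, Finset.mem_coe, Equiv.Perm.mem_support, ne_eq, hfix,
    Set.mem_ofPred_eq]
  constructor
  · rintro ⟨w, hw, rfl⟩
    exact ⟨(mem_rootSet.mp w.2).2, hw⟩
  · rintro ⟨hz, him⟩
    exact ⟨⟨z, mem_rootSet.mpr ⟨hf, hz⟩⟩, him, rfl⟩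

/-- If an irreducible polynomial over ℚ of prime degree p > 37 has exactly 10 non-real
complex roots, then its Galois group is A_p or S_p. -/
theorem galois_group_eq_alternating_or_symmetric_of_10_nonreal_roots
    (f : ℚ[X]) (p : ℕ) (hp : p.Prime) (hpgt : 37 < p)
    (hdeg : f.natDegree = p) (hirr : Irreducible f)
    (hroots : {z : ℂ | aeval z f = 0 ∧ z.im ≠ 0}.ncard = 10) :
    Nonempty (f.Gal ≃* alternatingGroup (Fin p)) ∨
      Nonempty (f.Gal ≃* Equiv.Perm (Fin p)) := by
  have : Fact ((f.map (algebraMap ℚ ℂ)).Splits) := ⟨IsAlgClosed.splits _⟩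
  have hcard : Fintype.card (f.rootSet ℂ) = p := by
    rw [← hdeg, card_rootSet_eq_natDegree hirr.separable (IsAlgClosed.splits _)]
  have hnontriv : Nontrivial (f.rootSet ℂ) := by
    rw [← Fintype.one_lt_card_iff_nontrivial]
    omega
  let φ := Gal.galActionHom f ℂ
  let e : f.Gal ≃* φ.range := MonoidHom.ofInjective (Gal.galActionHom_injective f ℂ)
  let r : f.rootSet ℂ ≃ Fin p := Fintype.equivFinOfCardEq hcard
  have hle : alternatingGroup (f.rootSet ℂ) ≤ φ.range := by
    refine alternatingGroup_le_of_involution_card_support_eq_ten hp hpgt hcard φ.range ?_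
      (φ (Gal.restrict f ℂ (AlgEquiv.restrictScalars ℚ Complex.conjAe))) ⟨_, rfl⟩ ?_ ?_
    · rw [← Nat.card_congr e.toEquiv, ← hdeg]
      exact Gal.prime_degree_dvd_card hirr (hdeg ▸ hp)
    · intro x
      rw [Subtype.ext_iff, Gal.galActionHom_restrict, Gal.galActionHom_restrict]
      exact Complex.conj_conj _
    · rw [← hroots, ← card_support_galActionHom_conj f hirr.ne_zero]
  rcases eq_alternatingGroup_or_eq_top_of_alternatingGroup_le _ hle with h | h
  · exact Or.inl ⟨e.trans ((MulEquiv.subgroupCongr h).trans r.altCongrHom)⟩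
  · exact Or.inr ⟨e.trans ((MulEquiv.subgroupCongr h).trans
      (Subgroup.topEquiv.trans r.permCongrHom))⟩
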